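/- Let N ∼ Binomial(n, p), and let r, s ≥ 1 be integers and a, b ≥ 1 real constants. Then 0 ≤ E[1/((a+N)^r (b+N)^s)] − 1/((a+np)^r (b+np)^s) ≤ C [1/((a+np)^{r+1}(b+np)^s) + 1/((a+np)^r(b+np)^{s+1})] for a constant C depending only on r and s. -/

import Mathlib

/-- Expectation of `f(N)` for `N ~ Binomial(n, p)`. -/
noncomputable def binExp (n : ℕ) (p : ℝ) (f : ℕ → ℝ) : ℝ :=
  ∑ k ∈ Finset.range (n + 1), (n.choose k : ℝ) * p ^ k * (1 - p) ^ (n - k) * f k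

theorem binExp_add (n : ℕ) (p : ℝ) (f g : ℕ → ℝ) :
    binExp n p (fun k => f k + g k) = binExp n p f + binExp n p g := by
  simp only [binExp, mul_add, Finset.sum_add_distrib]

theorem binExp_const_mul (n : ℕ) (p c : ℝ) (f : ℕ → ℝ) :
    binExp n p (fun k => c * f k) = c * binExp n p f := by
  simp only [binExp, Finset.mul_sum]
  exact Finset.sum_congr rfl fun k _ => by ring

theorem binExp_const (n : ℕ) (p c : ℝ) : binExp n p (fun _ => c) = c := by
  have h := add_pow p (1 - p) n
  rw [add_sub_cancel, one_pow] at h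
  rw [binExp, ← Finset.sum_mul]
  conv_rhs => rw [← one_mul c, h]
  congr 1
  exact Finset.sum_congr rfl fun k _ => by ring

theorem binExp_mono {n : ℕ} {p : ℝ} (hp0 : 0 ≤ p) (hp1 : p ≤ 1) {f g : ℕ → ℝ}
    (hfg : ∀ k, f k ≤ g k) : binExp n p f ≤ binExp n p g := by
  have hq : 0 ≤ 1 - p := sub_nonneg.2 hp1
  exact Finset.sum_le_sum fun k _ => mul_le_mul_of_nonneg_left (hfg k) (by positivity)

theorem one_sub_mul_binExp_mul (n : ℕ) (p : ℝ) (h : ℕ → ℝ) :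
    (1 - p) * binExp n p (fun k => (k : ℝ) * h k)
      = p * binExp n p (fun k => ((n : ℝ) - k) * h (k + 1)) := by
  rw [binExp, binExp, Finset.sum_range_succ', Finset.sum_range_succ]
  simp only [Nat.cast_zero, zero_mul, mul_zero, add_zero, sub_self, Finset.mul_sum]
  refine Finset.sum_congr rfl fun k hk => ?_
  have hkn : k < n := Finset.mem_range.1 hk
  have hc : (n.choose (k + 1) : ℝ) * ((k : ℝ) + 1) = n.choose k * ((n : ℝ) - k) := by
    rw [← Nat.cast_sub hkn.le]
    exact_mod_cast Nat.choose_succ_right_eq n k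
  have he : n - k = n - (k + 1) + 1 := by omega
  rw [he, pow_succ, pow_succ]
  push_cast
  linear_combination p ^ k * p * (1 - p) ^ (n - (k + 1)) * (1 - p) * h (k + 1) * hc

theorem binExp_mul_eq (n : ℕ) (p : ℝ) (h : ℕ → ℝ) :
    binExp n p (fun k => (k : ℝ) * h k)
      = n * p * binExp n p (fun k => h (k + 1))
        + p * binExp n p (fun k => (k : ℝ) * (h k - h (k + 1))) := by
  have h1 := one_sub_mul_binExp_mul n p h
  have h2 : binExp n p (fun k => ((n : ℝ) - k) * h (k + 1))
      = n * binExp n p (fun k => h (k + 1))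
        + (-1) * binExp n p (fun k => (k : ℝ) * h (k + 1)) := by
    rw [← binExp_const_mul, ← binExp_const_mul, ← binExp_add]
    congr 1; funext k; ring
  have h3 : binExp n p (fun k => (k : ℝ) * (h k - h (k + 1)))
      = binExp n p (fun k => (k : ℝ) * h k)
        + (-1) * binExp n p (fun k => (k : ℝ) * h (k + 1)) := by
    rw [← binExp_const_mul, ← binExp_add]
    congr 1; funext k; ring
  rw [h2] at h1
  rw [h3]
  linear_combination h1

theorem binExp_natCast (n : ℕ) (p : ℝ) : binExp n p (fun k => (k : ℝ)) = n * p := by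
  have h := binExp_mul_eq n p (fun _ => 1)
  simpa [binExp_const] using h

theorem mul_binExp_succ_le {n : ℕ} {p : ℝ} (hp0 : 0 ≤ p) (hp1 : p ≤ 1) {h : ℕ → ℝ}
    (hh : ∀ k, h (k + 1) ≤ h k) :
    n * p * binExp n p (fun k => h (k + 1)) ≤ binExp n p (fun k => (k : ℝ) * h k) := by
  rw [binExp_mul_eq]
  have h0 : 0 ≤ binExp n p (fun k => (k : ℝ) * (h k - h (k + 1))) := by
    rw [← binExp_const n p 0]
    exact binExp_mono hp0 hp1 fun k => mul_nonneg k.cast_nonneg (sub_nonneg.2 (hh k))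
  linarith [mul_nonneg hp0 h0]

/-- The normalized negative moment `E[((a + np) / (a + N))^t]` for `N ~ Binomial(n, p)`. -/
noncomputable def negMoment (n : ℕ) (p a : ℝ) (t : ℕ) : ℝ :=
  binExp n p (fun k => ((a + n * p) / (a + k)) ^ t)

theorem add_mul_negMoment_succ_le {n : ℕ} {p a : ℝ} (hp0 : 0 ≤ p) (hp1 : p ≤ 1) (ha : 1 ≤ a)
    (t : ℕ) :
    a * negMoment n p a (t + 1)
        + n * p * binExp n p (fun k => ((a + n * p) / (a + ((k + 1 : ℕ) : ℝ))) ^ (t + 1))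
      ≤ (a + n * p) * negMoment n p a t := by
  have hA : 0 < a + n * p := by positivity
  have hmono := mul_binExp_succ_le (n := n) hp0 hp1
    (h := fun k => ((a + n * p) / (a + (k : ℝ))) ^ (t + 1)) (fun k => by
      have : (k : ℝ) ≤ ((k + 1 : ℕ) : ℝ) := by exact_mod_cast k.le_succ
      gcongr)
  have heq : (a + n * p) * negMoment n p a t = a * negMoment n p a (t + 1)
      + binExp n p (fun k => (k : ℝ) * ((a + n * p) / (a + (k : ℝ))) ^ (t + 1)) := by
    rw [negMoment, negMoment, ← binExp_const_mul, ← binExp_const_mul, ← binExp_add]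
    congr 1; funext k
    have hX : a + (k : ℝ) ≠ 0 := by positivity
    rw [pow_succ]
    field_simp
  linarith

theorem negMoment_succ_le {n : ℕ} {p a : ℝ} (hp0 : 0 ≤ p) (hp1 : p ≤ 1) (ha : 1 ≤ a) (t : ℕ) :
    negMoment n p a (t + 1) ≤ 2 ^ (t + 1) * negMoment n p a t := by
  have hA : 0 < a + n * p := by positivity
  have h1 := add_mul_negMoment_succ_le (n := n) hp0 hp1 ha t
  have h2 : negMoment n p a (t + 1)
      ≤ 2 ^ (t + 1) * binExp n p (fun k => ((a + n * p) / (a + ((k + 1 : ℕ) : ℝ))) ^ (t + 1)) := by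
    rw [negMoment, ← binExp_const_mul]
    refine binExp_mono hp0 hp1 fun k => ?_
    rw [← mul_pow]
    gcongr
    have hk : (0 : ℝ) ≤ k := k.cast_nonneg
    push_cast
    rw [← mul_div_assoc, div_le_div_iff₀ (by positivity) (by positivity)]
    nlinarith
  have h0 : 0 ≤ negMoment n p a (t + 1) := by
    rw [negMoment, ← binExp_const n p 0]
    exact binExp_mono hp0 hp1 fun k => by positivity
  have h3 : a * negMoment n p a (t + 1) ≤ 2 ^ (t + 1) * (a * negMoment n p a (t + 1)) :=
    le_mul_of_one_le_left (by positivity) (one_le_pow₀ one_le_two)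
  refine le_of_mul_le_mul_left ?_ hA
  have h4 := mul_le_mul_of_nonneg_left h2 (by positivity : 0 ≤ n * p)
  have h5 := mul_le_mul_of_nonneg_left h1 (by positivity : (0 : ℝ) ≤ 2 ^ (t + 1))
  linarith

theorem exists_negMoment_le (t : ℕ) : ∃ K : ℝ, 0 < K ∧ ∀ (n : ℕ) (p a : ℝ), 0 ≤ p → p ≤ 1 →
    1 ≤ a → negMoment n p a t ≤ K := by
  induction t with
  | zero => exact ⟨1, one_pos, fun n p a _ _ _ => by simp [negMoment, binExp_const]⟩
  | succ t ih =>
    obtain ⟨K, hK, h⟩ := ih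
    refine ⟨2 ^ (t + 1) * K, by positivity, fun n p a hp0 hp1 ha => ?_⟩
    exact (negMoment_succ_le hp0 hp1 ha t).trans
      (mul_le_mul_of_nonneg_left (h n p a hp0 hp1 ha) (by positivity))

theorem div_pow_le_div_add_one_pow_add {A x : ℝ} (hA : 0 < A) (hx : 0 < x) (t : ℕ) :
    (A / x) ^ t ≤ (A / (x + 1)) ^ t + t / A * (A / x) ^ (t + 1) := by
  have hB : 1 + (t : ℝ) * (-(1 / (x + 1))) ≤ (1 + -(1 / (x + 1))) ^ t := by
    refine one_add_mul_le_pow ?_ t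
    have : 1 / (x + 1) ≤ 1 := by rw [div_le_one (by positivity)]; linarith
    linarith
  have hle : (t : ℝ) * (1 / (x + 1)) ≤ t * (1 / x) := by gcongr; linarith
  have hB' : 1 ≤ (1 + -(1 / (x + 1))) ^ t + t * (1 / x) := by linarith
  have e1 : A / (x + 1) = A / x * (1 + -(1 / (x + 1))) := by field_simp; ring
  have e2 : t / A * (A / x) ^ (t + 1) = (A / x) ^ t * (t * (1 / x)) := by
    rw [pow_succ]; field_simp
  rw [e1, mul_pow, e2, ← mul_add]
  exact le_mul_of_one_le_right (by positivity) hB'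

theorem negMoment_succ_le_add {n : ℕ} {p a : ℝ} (hp0 : 0 ≤ p) (hp1 : p ≤ 1) (ha : 1 ≤ a)
    (t : ℕ) :
    negMoment n p a (t + 1) ≤ negMoment n p a t
      + ((t + 1 : ℕ) : ℝ) / (a + n * p) * negMoment n p a (t + 2) := by
  have hA : 0 < a + n * p := by positivity
  have h1 := add_mul_negMoment_succ_le (n := n) hp0 hp1 ha t
  have h2 : negMoment n p a (t + 1)
      ≤ binExp n p (fun k => ((a + n * p) / (a + ((k + 1 : ℕ) : ℝ))) ^ (t + 1))
        + ((t + 1 : ℕ) : ℝ) / (a + n * p) * negMoment n p a (t + 2) := by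
    rw [negMoment, negMoment, ← binExp_const_mul, ← binExp_add]
    refine binExp_mono hp0 hp1 fun k => ?_
    have := div_pow_le_div_add_one_pow_add hA (by positivity : 0 < a + (k : ℝ)) (t + 1)
    rwa [show a + ((k + 1 : ℕ) : ℝ) = a + (k : ℝ) + 1 by push_cast; ring]
  have h0 : 0 ≤ negMoment n p a (t + 2) := by
    rw [negMoment, ← binExp_const n p 0]
    exact binExp_mono hp0 hp1 fun k => by positivity
  have h3 : 0 ≤ a * (((t + 1 : ℕ) : ℝ) / (a + n * p) * negMoment n p a (t + 2)) := by positivity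
  refine le_of_mul_le_mul_left ?_ hA
  have h4 := mul_le_mul_of_nonneg_left h2 (by positivity : 0 ≤ n * p)
  linarith

theorem exists_negMoment_le_one_add (t : ℕ) : ∃ C : ℝ, 0 < C ∧ ∀ (n : ℕ) (p a : ℝ), 0 ≤ p →
    p ≤ 1 → 1 ≤ a → negMoment n p a t ≤ 1 + C / (a + n * p) := by
  induction t with
  | zero =>
    refine ⟨1, one_pos, fun n p a hp0 _ ha => ?_⟩
    have : 0 ≤ 1 / (a + n * p) := by positivity
    simpa [negMoment, binExp_const] using this
  | succ t ih =>
    obtain ⟨C, hC, h⟩ := ih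
    obtain ⟨K, hK, hKle⟩ := exists_negMoment_le (t + 2)
    refine ⟨C + ((t + 1 : ℕ) : ℝ) * K, by positivity, fun n p a hp0 hp1 ha => ?_⟩
    have h1 := negMoment_succ_le_add (n := n) hp0 hp1 ha t
    have h2 := mul_le_mul_of_nonneg_left (hKle n p a hp0 hp1 ha)
      (by positivity : 0 ≤ ((t + 1 : ℕ) : ℝ) / (a + n * p))
    have h3 := h n p a hp0 hp1 ha
    calc negMoment n p a (t + 1)
        ≤ 1 + C / (a + n * p) + ((t + 1 : ℕ) : ℝ) / (a + n * p) * K := by linarith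
      _ = 1 + (C + ((t + 1 : ℕ) : ℝ) * K) / (a + n * p) := by ring

theorem pow_mul_pow_le_weighted {x y : ℝ} (hx : 0 ≤ x) (hy : 0 ≤ y) {r s : ℕ} (hr : 1 ≤ r) :
    x ^ r * y ^ s
      ≤ (r : ℝ) / (r + s) * x ^ (r + s) + (s : ℝ) / (r + s) * y ^ (r + s) := by
  have hr' : (0 : ℝ) < r := by exact_mod_cast hr
  have ht : (0 : ℝ) < r + s := by positivity
  have key : ∀ (z : ℝ) (m : ℕ), 0 ≤ z → (z ^ (r + s)) ^ ((m : ℝ) / (r + s)) = z ^ m := by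
    intro z m hz
    rw [← Real.rpow_natCast z (r + s), ← Real.rpow_mul hz, Nat.cast_add,
      mul_div_cancel₀ _ ht.ne', Real.rpow_natCast]
  have h := Real.geom_mean_le_arith_mean2_weighted (w₁ := (r : ℝ) / (r + s))
    (w₂ := (s : ℝ) / (r + s)) (by positivity) (by positivity)
    (pow_nonneg hx (r + s)) (pow_nonneg hy (r + s)) (by field_simp)
  rwa [key x r hx, key y s hy] at h

theorem one_sub_sub_le_inv_pow_mul_inv_pow {u v : ℝ} (hu : 0 < u) (hv : 0 < v) (r s : ℕ) :
    1 - r * (u - 1) - s * (v - 1) ≤ u⁻¹ ^ r * v⁻¹ ^ s := by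
  have key : ∀ w : ℝ, 0 < w → ∀ m : ℕ, Real.exp (-(m * (w - 1))) ≤ w⁻¹ ^ m := by
    intro w hw m
    have h : w ≤ Real.exp (w - 1) := by linarith [Real.add_one_le_exp (w - 1)]
    rw [Real.exp_neg, Real.exp_nat_mul, inv_pow]
    gcongr
  calc 1 - r * (u - 1) - s * (v - 1)
      ≤ Real.exp (-(r * (u - 1)) + -(s * (v - 1))) := by
        linarith [Real.add_one_le_exp (-(r * (u - 1)) + -(s * (v - 1)))]
    _ ≤ u⁻¹ ^ r * v⁻¹ ^ s := by
        rw [Real.exp_add]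
        exact mul_le_mul (key u hu r) (key v hv s) (Real.exp_pos _).le (by positivity)

theorem one_le_binExp_div_pow_mul_div_pow {n : ℕ} {p a b : ℝ} (hp0 : 0 ≤ p) (hp1 : p ≤ 1)
    (ha : 1 ≤ a) (hb : 1 ≤ b) (r s : ℕ) :
    1 ≤ binExp n p (fun k => ((a + n * p) / (a + k)) ^ r * ((b + n * p) / (b + k)) ^ s) := by
  have hA : 0 < a + n * p := by positivity
  have hB : 0 < b + n * p := by positivity
  have hlin : binExp n p (fun k => (1 + (r / (a + n * p) + s / (b + n * p)) * (n * p))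
      + (-(r / (a + n * p) + s / (b + n * p))) * (k : ℝ)) = 1 := by
    rw [binExp_add, binExp_const_mul, binExp_const, binExp_natCast]
    ring
  rw [← hlin]
  refine binExp_mono hp0 hp1 fun k => ?_
  have hu : 0 < (a + k) / (a + n * p) := by positivity
  have hv : 0 < (b + k) / (b + n * p) := by positivity
  have h := one_sub_sub_le_inv_pow_mul_inv_pow hu hv r s
  rw [inv_div, inv_div] at h
  refine le_trans (le_of_eq ?_) h
  field_simp
  ring

theorem exists_binExp_div_pow_mul_div_pow_le {r : ℕ} (hr : 1 ≤ r) (s : ℕ) :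
    ∃ C : ℝ, 0 < C ∧ ∀ (n : ℕ) (p a b : ℝ), 0 ≤ p → p ≤ 1 → 1 ≤ a → 1 ≤ b →
      binExp n p (fun k => ((a + n * p) / (a + k)) ^ r * ((b + n * p) / (b + k)) ^ s)
        ≤ 1 + C * (1 / (a + n * p) + 1 / (b + n * p)) := by
  obtain ⟨C, hC, h⟩ := exists_negMoment_le_one_add (r + s)
  refine ⟨C, hC, fun n p a b hp0 hp1 ha hb => ?_⟩
  have hr' : (0 : ℝ) < r := by exact_mod_cast hr
  have h1 : binExp n p (fun k => ((a + n * p) / (a + k)) ^ r * ((b + n * p) / (b + k)) ^ s)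
      ≤ (r : ℝ) / (r + s) * negMoment n p a (r + s)
        + (s : ℝ) / (r + s) * negMoment n p b (r + s) := by
    rw [negMoment, negMoment, ← binExp_const_mul, ← binExp_const_mul, ← binExp_add]
    exact binExp_mono hp0 hp1 fun k =>
      pow_mul_pow_le_weighted (by positivity) (by positivity) hr
  have hw : (r : ℝ) / (r + s) + (s : ℝ) / (r + s) = 1 := by field_simp
  have hw1 : 0 ≤ (r : ℝ) / (r + s) := by positivity
  have hw2 : 0 ≤ (s : ℝ) / (r + s) := by positivity
  have hA : 0 ≤ C / (a + n * p) := by positivity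
  have hB : 0 ≤ C / (b + n * p) := by positivity
  have e : C * (1 / (a + n * p) + 1 / (b + n * p)) = C / (a + n * p) + C / (b + n * p) := by ring
  rw [e]
  generalize (r : ℝ) / (r + s) = w at *
  generalize (s : ℝ) / (r + s) = z at *
  nlinarith [mul_le_mul_of_nonneg_left (h n p a hp0 hp1 ha) hw1,
    mul_le_mul_of_nonneg_left (h n p b hp0 hp1 hb) hw2, mul_nonneg hw2 hA, mul_nonneg hw1 hB]

/-- for `N ~ Binomial(n,p)`, integers `r, s ≥ 1` and reals `a, b ≥ 1`,
`0 ≤ E[1/((a+N)^r (b+N)^s)] − 1/((a+np)^r (b+np)^s)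
   ≤ C [1/((a+np)^{r+1}(b+np)^s) + 1/((a+np)^r(b+np)^{s+1})]`
with `C` depending only on `r` and `s`. -/
theorem stmt4 (r s : ℕ) (hr : 1 ≤ r) (hs : 1 ≤ s) :
    ∃ C : ℝ, 0 < C ∧ ∀ (n : ℕ) (p a b : ℝ), 0 ≤ p → p ≤ 1 → 1 ≤ a → 1 ≤ b →
      0 ≤ binExp n p (fun k => 1 / ((a + (k : ℝ)) ^ r * (b + (k : ℝ)) ^ s))
            - 1 / ((a + (n : ℝ) * p) ^ r * (b + (n : ℝ) * p) ^ s) ∧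
      binExp n p (fun k => 1 / ((a + (k : ℝ)) ^ r * (b + (k : ℝ)) ^ s))
            - 1 / ((a + (n : ℝ) * p) ^ r * (b + (n : ℝ) * p) ^ s)
        ≤ C * (1 / ((a + (n : ℝ) * p) ^ (r + 1) * (b + (n : ℝ) * p) ^ s)
              + 1 / ((a + (n : ℝ) * p) ^ r * (b + (n : ℝ) * p) ^ (s + 1))) := by
  obtain ⟨C, hC, hle⟩ := exists_binExp_div_pow_mul_div_pow_le hr s
  refine ⟨C, hC, fun n p a b hp0 hp1 ha hb => ?_⟩
  have hA : 0 < a + n * p := by positivity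
  have hB : 0 < b + n * p := by positivity
  have heq : binExp n p (fun k => 1 / ((a + (k : ℝ)) ^ r * (b + (k : ℝ)) ^ s))
      = 1 / ((a + n * p) ^ r * (b + n * p) ^ s)
        * binExp n p (fun k => ((a + n * p) / (a + k)) ^ r * ((b + n * p) / (b + k)) ^ s) := by
    rw [← binExp_const_mul]
    congr 1; funext k
    have hX : 0 < a + (k : ℝ) := by positivity
    have hY : 0 < b + (k : ℝ) := by positivity
    rw [div_pow, div_pow]
    field_simp
  have hf : 0 < 1 / ((a + n * p) ^ r * (b + n * p) ^ s) := by positivity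
  have h1 := mul_le_mul_of_nonneg_left
    (one_le_binExp_div_pow_mul_div_pow (n := n) hp0 hp1 ha hb r s) hf.le
  have h2 := mul_le_mul_of_nonneg_left (hle n p a b hp0 hp1 ha hb) hf.le
  have e : 1 / ((a + n * p) ^ (r + 1) * (b + n * p) ^ s)
      + 1 / ((a + n * p) ^ r * (b + n * p) ^ (s + 1))
      = 1 / ((a + n * p) ^ r * (b + n * p) ^ s) * (1 / (a + n * p) + 1 / (b + n * p)) := by
    rw [pow_succ, pow_succ]
    field_simp
  rw [heq, e]
  constructor <;> linarith
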